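/- Let m ≥ 1, let a > 0, b > 0 be real numbers and c ∈ ℝ. The function F : ℝ^m → ℝ defined by F(φ_1, …, φ_m) = exp( c·φ_1 − a·e^{−φ_1} − ∑_{k=1}^{m−1} e^{φ_k − φ_{k+1}} − b·e^{φ_m} ) is integrable on ℝ^m with respect to m-dimensional Lebesgue measure. -/

import Mathlib

open MeasureTheory

/-- The exponential dominates every linear growth rate, up to an additive constant. -/
lemma mul_max_zero_le_mul_exp {a : ℝ} (ha : 0 < a) (t x : ℝ) :
    t * max x 0 ≤ a * Real.exp x + t ^ 2 / (2 * a) := by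
  have hquad : max x 0 ^ 2 / 2 ≤ Real.exp x := by
    rcases le_total x 0 with hx | hx
    · simpa [hx] using (Real.exp_pos x).le
    · rw [max_eq_left hx]
      linarith [Real.quadratic_le_exp_of_nonneg hx]
  have hsq : t * max x 0 ≤ a * (max x 0 ^ 2 / 2) + t ^ 2 / (2 * a) := by
    have h : a * (max x 0 ^ 2 / 2) + t ^ 2 / (2 * a) - t * max x 0
        = (a * max x 0 - t) ^ 2 / (2 * a) := by
      field_simp
      ring
    have : 0 ≤ (a * max x 0 - t) ^ 2 / (2 * a) := by positivity
    linarith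
  linarith [mul_le_mul_of_nonneg_left hquad ha.le]

/-- Coercivity of the open Toda chain, up to the positive part of the last coordinate. -/
lemma exists_sum_abs_le_toda_open {a : ℝ} (ha : 0 < a) (c : ℝ) (n : ℕ) {L : ℝ} (hL : 0 ≤ L) :
    ∃ t C : ℝ, ∀ ψ : ℕ → ℝ,
      c * ψ 0 + L * ∑ k ∈ Finset.range (n + 1), |ψ k| ≤
        a * Real.exp (-ψ 0) + ∑ k ∈ Finset.range n, Real.exp (ψ k - ψ (k + 1))
          + t * max (ψ n) 0 + C := by
  induction n generalizing L with
  | zero =>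
    refine ⟨|c| + L, (|c| + L) ^ 2 / (2 * a), fun ψ => ?_⟩
    have h := mul_max_zero_le_mul_exp ha (|c| + L) (-ψ 0)
    have hc : c * ψ 0 ≤ |c| * |ψ 0| := (le_abs_self _).trans (abs_mul _ _).le
    have habs : |ψ 0| = max (ψ 0) 0 + max (-ψ 0) 0 := by
      rcases le_total (ψ 0) 0 with h0 | h0
      · simp [abs_of_nonpos, h0]
      · simp [abs_of_nonneg, h0]
    simp only [zero_add, Finset.sum_range_one, Finset.range_zero, Finset.sum_empty, add_zero]
    calc c * ψ 0 + L * |ψ 0| ≤ (|c| + L) * |ψ 0| := by linarith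
      _ = (|c| + L) * max (ψ 0) 0 + (|c| + L) * max (-ψ 0) 0 := by rw [habs]; ring
      _ ≤ _ := by linarith
  | succ n ih =>
    obtain ⟨t, C, h⟩ := ih (L := 2 * L) (by positivity)
    refine ⟨|t| + L, C + (|t| + L) ^ 2 / (2 * 1), fun ψ => ?_⟩
    have hlink := mul_max_zero_le_mul_exp one_pos (|t| + L) (ψ n - ψ (n + 1))
    have hpos : t * max (ψ n) 0 ≤
        |t| * (max (ψ n - ψ (n + 1)) 0 + max (ψ (n + 1)) 0) := by
      refine mul_le_mul (le_abs_self t) ?_ (le_max_right _ _) (abs_nonneg t)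
      refine max_le ?_ (by positivity)
      linarith [le_max_left (ψ n - ψ (n + 1)) 0, le_max_left (ψ (n + 1)) 0]
    have habs : L * |ψ (n + 1)| ≤
        L * (max (ψ (n + 1)) 0 + max (ψ n - ψ (n + 1)) 0
          + ∑ k ∈ Finset.range (n + 1), |ψ k|) := by
      refine mul_le_mul_of_nonneg_left ?_ hL
      have hlast : |ψ n| ≤ ∑ k ∈ Finset.range (n + 1), |ψ k| :=
        Finset.single_le_sum (f := fun k => |ψ k|) (fun _ _ => abs_nonneg _)
          (Finset.self_mem_range_succ n)
      refine abs_le'.mpr ⟨?_, ?_⟩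
      · linarith [le_max_left (ψ (n + 1)) 0, le_max_right (ψ n - ψ (n + 1)) 0, abs_nonneg (ψ n)]
      · linarith [le_max_right (ψ (n + 1)) 0, le_max_left (ψ n - ψ (n + 1)) 0, neg_abs_le (ψ n)]
    rw [Finset.sum_range_succ _ (n + 1),
      Finset.sum_range_succ (fun k => Real.exp (ψ k - ψ (k + 1))) n]
    linarith [h ψ]

/-- Coercivity of the Toda chain with exponential walls at both ends. -/
lemma exists_sum_abs_le_toda {a b : ℝ} (ha : 0 < a) (hb : 0 < b) (c : ℝ) (n : ℕ) :
    ∃ C : ℝ, ∀ ψ : ℕ → ℝ,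
      c * ψ 0 + ∑ k ∈ Finset.range (n + 1), |ψ k| ≤
        a * Real.exp (-ψ 0) + ∑ k ∈ Finset.range n, Real.exp (ψ k - ψ (k + 1))
          + b * Real.exp (ψ n) + C := by
  obtain ⟨t, C, h⟩ := exists_sum_abs_le_toda_open ha c n zero_le_one
  refine ⟨C + t ^ 2 / (2 * b), fun ψ => ?_⟩
  linarith [h ψ, mul_max_zero_le_mul_exp hb t (ψ n)]

lemma integrable_exp_neg_sum_abs (ι : Type*) [Fintype ι] :
    Integrable (fun φ : ι → ℝ => Real.exp (-∑ i, |φ i|)) := by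
  have h : Integrable (fun x : ℝ => Real.exp (-|x|)) := by
    rw [← integrableOn_univ, ← Set.Iic_union_Ioi (a := (0 : ℝ))]
    refine IntegrableOn.union ?_ ?_
    · exact (integrableOn_exp_Iic 0).congr_fun
        (fun x hx => by simp [abs_of_nonpos (Set.mem_Iic.mp hx)]) measurableSet_Iic
    · exact (integrableOn_exp_neg_Ioi 0).congr_fun
        (fun x hx => by simp [abs_of_pos (Set.mem_Ioi.mp hx)]) measurableSet_Ioi
  simp_rw [← Finset.sum_neg_distrib, Real.exp_sum]
  exact Integrable.fintype_prod (fun _ => h)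

/-- For `m ≥ 1`, `a, b > 0` and any real `c`, the function
`F(φ_1, …, φ_m) = exp(c·φ_1 − a·e^{−φ_1} − ∑_{k=1}^{m−1} e^{φ_k − φ_{k+1}} − b·e^{φ_m})`
is Lebesgue-integrable on `ℝ^m`. -/
theorem integrable_toda_chain (m : ℕ) (hm : 1 ≤ m) (a b c : ℝ) (ha : 0 < a) (hb : 0 < b) :
    Integrable (fun φ : Fin m → ℝ =>
      Real.exp (c * φ ⟨0, by omega⟩ - a * Real.exp (-(φ ⟨0, by omega⟩))
        - (∑ k : Fin (m - 1),
            Real.exp (φ ⟨k.1, by have := k.isLt; omega⟩ - φ ⟨k.1 + 1, by have := k.isLt; omega⟩))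
        - b * Real.exp (φ ⟨m - 1, by omega⟩))) := by
  obtain ⟨n, rfl⟩ : ∃ n, m = n + 1 := ⟨m - 1, by omega⟩
  obtain ⟨C, hC⟩ := exists_sum_abs_le_toda ha hb c n
  refine ((integrable_exp_neg_sum_abs (Fin (n + 1))).const_mul (Real.exp C)).mono'
    (Continuous.aestronglyMeasurable (by fun_prop)) (Filter.Eventually.of_forall fun φ => ?_)
  rw [Real.norm_of_nonneg (Real.exp_pos _).le, ← Real.exp_add, Real.exp_le_exp]
  have h := hC fun k => if hk : k < n + 1 then φ ⟨k, hk⟩ else 0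
  have hlt (i : Fin n) : (i : ℕ) < n + 1 := i.isLt.trans n.lt_succ_self
  simp only [Finset.sum_range, Fin.is_lt, hlt, add_lt_add_iff_right, Nat.lt_succ_self,
    Nat.succ_pos, dite_true, Fin.eta] at h
  change c * φ ⟨0, n.succ_pos⟩ - a * Real.exp (-φ ⟨0, n.succ_pos⟩)
    - (∑ k : Fin n, Real.exp (φ ⟨k, hlt k⟩ - φ ⟨k + 1, Nat.succ_lt_succ k.isLt⟩))
    - b * Real.exp (φ ⟨n, n.lt_succ_self⟩) ≤ _
  linarith
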